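/- arXiv:0801.0396 — 2 statements merged into one kernel-verified Lean document; each statement's English description precedes it below -/
import Mathlib

section
/- The number of conjugacy classes of the group of 4×4 upper unitriangular matrices over F_q equals 2q^3 + q^2 - 2q; equivalently, writing v = q - 1, it equals 2v^3 + 7v^2 + 6v + 1. -/
open Matrix

def IsUnitriangular {n : ℕ} {F : Type*} [Field F] (M : Matrix (Fin n) (Fin n) F) : Prop :=
  (∀ i, M i i = 1) ∧ ∀ i j : Fin n, j < i → M i j = 0

theorem IsUnitriangular.blockTriangular {n : ℕ} {F : Type*} [Field F]
    {M : Matrix (Fin n) (Fin n) F} (h : IsUnitriangular M) :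
    M.BlockTriangular id := fun _ _ hij => h.2 _ _ hij

theorem diag_mul_of_tri {n : ℕ} {F : Type*} [Field F]
    {A B : Matrix (Fin n) (Fin n) F} (hA : A.BlockTriangular id)
    (hB : B.BlockTriangular id) (i : Fin n) : (A * B) i i = A i i * B i i := by
  rw [Matrix.mul_apply]
  refine Finset.sum_eq_single i ?_ (by simp)
  intro k _ hk
  rcases lt_or_gt_of_ne hk with h | h
  · rw [hA (show (id k : Fin n) < id i from h), zero_mul]
  · rw [hB (show (id i : Fin n) < id k from h), mul_zero]

def UT (n : ℕ) (F : Type*) [Field F] : Subgroup (GL (Fin n) F) where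
  carrier := {M | IsUnitriangular (M : Matrix (Fin n) (Fin n) F)}
  one_mem' := ⟨fun i => by simp, fun i j hij => by
    simp [Matrix.one_apply, (ne_of_lt hij).symm]⟩
  mul_mem' := by
    rintro A B ⟨hA1, hA2⟩ ⟨hB1, hB2⟩
    constructor
    · intro i
      have := diag_mul_of_tri (A := (A : Matrix (Fin n) (Fin n) F)) (B := B)
        (fun _ _ h => hA2 _ _ h) (fun _ _ h => hB2 _ _ h) i
      simpa [hA1 i, hB1 i] using this
    · intro i j hij
      have := Matrix.BlockTriangular.mul (M := (A : Matrix (Fin n) (Fin n) F))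
        (N := (B : Matrix (Fin n) (Fin n) F)) (b := id)
        (fun _ _ h => hA2 _ _ h) (fun _ _ h => hB2 _ _ h)
      exact this hij
  inv_mem' := by
    rintro A ⟨hA1, hA2⟩
    have hbt : (A : Matrix (Fin n) (Fin n) F).BlockTriangular id := fun _ _ h => hA2 _ _ h
    have : Invertible (A : Matrix (Fin n) (Fin n) F) := A.invertible
    have hinv : ((A : Matrix (Fin n) (Fin n) F)⁻¹).BlockTriangular id :=
      blockTriangular_inv_of_blockTriangular hbt
    have hco : ((A⁻¹ : GL (Fin n) F) : Matrix (Fin n) (Fin n) F)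
        = (A : Matrix (Fin n) (Fin n) F)⁻¹ := by
      simp [Matrix.coe_units_inv]
    constructor
    · intro i
      have h1 : ((A : Matrix (Fin n) (Fin n) F) * (A : Matrix (Fin n) (Fin n) F)⁻¹) i i
          = (1 : Matrix (Fin n) (Fin n) F) i i := by
        rw [Matrix.mul_nonsing_inv _ (isUnit_det_of_invertible _)]
      rw [diag_mul_of_tri hbt hinv, hA1 i, one_mul] at h1
      rw [hco]
      simpa [Matrix.one_apply] using h1
    · intro i j hij
      rw [hco]
      exact hinv hij


namespace UTcount

variable {F : Type*} [Field F]

def mat (a b c d e f : F) : Matrix (Fin 4) (Fin 4) F :=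
  !![1, a, d, f; 0, 1, b, e; 0, 0, 1, c; 0, 0, 0, 1]

theorem mat_uni (a b c d e f : F) : IsUnitriangular (mat a b c d e f) := by
  constructor
  · intro i; fin_cases i <;> rfl
  · intro i j h
    fin_cases i <;> fin_cases j <;> first | rfl | (exfalso; revert h; decide)

theorem det_mat (a b c d e f : F) : (mat a b c d e f).det ≠ 0 := by
  rw [Matrix.det_of_upperTriangular (mat_uni a b c d e f).blockTriangular]
  simp [(mat_uni a b c d e f).1]

noncomputable def eqv : UT 4 F ≃ F × F × F × F × F × F where
  toFun A := (A.1.1 0 1, A.1.1 1 2, A.1.1 2 3, A.1.1 0 2, A.1.1 1 3, A.1.1 0 3)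
  invFun t := ⟨Matrix.GeneralLinearGroup.mkOfDetNeZero
    (mat t.1 t.2.1 t.2.2.1 t.2.2.2.1 t.2.2.2.2.1 t.2.2.2.2.2) (det_mat _ _ _ _ _ _),
    mat_uni _ _ _ _ _ _⟩
  left_inv A := by
    obtain ⟨A, h1, h2⟩ := A
    apply Subtype.ext
    apply Units.ext
    ext i j
    have H := h2 i j
    have H1 := h1 i
    revert H H1
    fin_cases i <;> fin_cases j <;>
      first
        | exact fun _ _ => rfl
        | exact fun _ h => h.symm
        | exact fun h _ => (h (by decide)).symm
  right_inv t := rfl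

theorem mat_eqv (A : UT 4 F) : (A.1.1 : Matrix (Fin 4) (Fin 4) F) =
    mat (eqv A).1 (eqv A).2.1 (eqv A).2.2.1 (eqv A).2.2.2.1 (eqv A).2.2.2.2.1
      (eqv A).2.2.2.2.2 := by
  conv_lhs => rw [← eqv.symm_apply_apply A]
  rfl

theorem mat_comm (a b c d e f a' b' c' d' e' f' : F) :
    mat a b c d e f * mat a' b' c' d' e' f' = mat a' b' c' d' e' f' * mat a b c d e f ↔
    (a * b' - a' * b = 0 ∧ b * c' - b' * c = 0 ∧
      (a * e' - a' * e) + (d * c' - d' * c) = 0) := by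
  constructor
  · intro h
    have h1 := congrFun (congrFun h 0) 2
    have h2 := congrFun (congrFun h 1) 3
    have h3 := congrFun (congrFun h 0) 3
    simp [mat, Matrix.mul_apply, Fin.sum_univ_four] at h1 h2 h3
    refine ⟨?_, ?_, ?_⟩
    · linear_combination h1
    · linear_combination h2
    · linear_combination h3
  · rintro ⟨h1, h2, h3⟩
    ext i j
    fin_cases i <;> fin_cases j <;> simp [mat, Matrix.mul_apply, Fin.sum_univ_four]
    · ring
    · linear_combination h1
    · linear_combination h3
    · ring
    · linear_combination h2
    · ring

def cr (u v : F × F) : F := u.1 * v.2 - u.2 * v.1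

def Cond (s t : F × F × F × F × F × F) : Prop :=
  cr (s.1, t.1) (s.2.1, t.2.1) = 0 ∧ cr (s.2.1, t.2.1) (s.2.2.1, t.2.2.1) = 0 ∧
  cr (s.1, t.1) (s.2.2.2.2.1, t.2.2.2.2.1) + cr (s.2.2.2.1, t.2.2.2.1) (s.2.2.1, t.2.2.1) = 0

theorem commute_iff (A B : UT 4 F) : Commute A B ↔ Cond (eqv A) (eqv B) := by
  rw [commute_iff_eq, Subtype.ext_iff, Units.ext_iff]
  change (A.1.1 * B.1.1 = B.1.1 * A.1.1) ↔ _
  rw [mat_eqv A, mat_eqv B, mat_comm]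
  rfl

variable (F) in
abbrev Par := (Σ v : F × F, Σ s : {u : F × F // cr u v = 0} × {w : F × F // cr v w = 0},
    {p : (F × F) × (F × F) // cr s.1.1 p.2 + cr p.1 s.2.1 = 0}) × (F × F)

noncomputable def eqv2 : {p : UT 4 F × UT 4 F // Commute p.1 p.2} ≃ Par F :=
  (Equiv.subtypeEquiv (Equiv.prodCongr eqv eqv)
    (q := fun p => Cond p.1 p.2) (fun p => commute_iff p.1 p.2)).trans
  { toFun := fun p => (⟨(p.1.1.2.1, p.1.2.2.1),
        ⟨⟨(p.1.1.1, p.1.2.1), p.2.1⟩, ⟨(p.1.1.2.2.1, p.1.2.2.2.1), p.2.2.1⟩⟩,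
        ⟨((p.1.1.2.2.2.1, p.1.2.2.2.2.1), (p.1.1.2.2.2.2.1, p.1.2.2.2.2.2.1)), p.2.2.2⟩⟩,
        (p.1.1.2.2.2.2.2, p.1.2.2.2.2.2.2))
    invFun := fun r => ⟨((r.1.2.1.1.1.1, r.1.1.1, r.1.2.1.2.1.1, r.1.2.2.1.1.1,
        r.1.2.2.1.2.1, r.2.1), (r.1.2.1.1.1.2, r.1.1.2, r.1.2.1.2.1.2, r.1.2.2.1.1.2,
        r.1.2.2.1.2.2, r.2.2)), r.1.2.1.1.2, r.1.2.1.2.2, r.1.2.2.2⟩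
    left_inv := fun _ => rfl
    right_inv := fun _ => rfl }

theorem card_ker [Fintype F] {V : Type*} [AddCommGroup V] [Module F V] [Finite V]
    (φ : V →ₗ[F] F) (h : φ ≠ 0) :
    Nat.card {v // φ v = 0} * Fintype.card F = Nat.card V := by
  have hs := LinearMap.surjective h
  have := AddSubgroup.card_mul_index φ.toAddMonoidHom.ker
  rw [AddSubgroup.index_ker, AddMonoidHom.range_eq_top.2 hs, Nat.card_congr
    (AddSubgroup.topEquiv (G := F)).toEquiv, Nat.card_eq_fintype_card (α := F)] at this
  exact this

def crL (v : F × F) : (F × F) →ₗ[F] F where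
  toFun u := cr u v
  map_add' x y := by simp [cr]; ring
  map_smul' c x := by simp [cr]; ring

def crR (v : F × F) : (F × F) →ₗ[F] F where
  toFun u := cr v u
  map_add' x y := by simp [cr]; ring
  map_smul' c x := by simp [cr]; ring

theorem crL_ne {v : F × F} (h : v ≠ 0) : crL v ≠ 0 := by
  intro h0
  apply h
  have h1 := LinearMap.congr_fun h0 (1, 0)
  have h2 := LinearMap.congr_fun h0 (0, 1)
  simp [crL, cr] at h1 h2
  exact Prod.ext h2 h1

theorem crR_ne {v : F × F} (h : v ≠ 0) : crR v ≠ 0 := by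
  intro h0
  apply h
  have h1 := LinearMap.congr_fun h0 (1, 0)
  have h2 := LinearMap.congr_fun h0 (0, 1)
  simp [crR, cr] at h1 h2
  exact Prod.ext h2 h1

variable [Fintype F]

theorem cardL (v : F × F) (h : v ≠ 0) : Nat.card {u : F × F // cr u v = 0} = Fintype.card F := by
  have := card_ker (crL v) (crL_ne h)
  rw [Nat.card_prod, Nat.card_eq_fintype_card (α := F)] at this
  exact Nat.eq_of_mul_eq_mul_right Fintype.card_pos this

theorem cardR (v : F × F) (h : v ≠ 0) : Nat.card {u : F × F // cr v u = 0} = Fintype.card F := by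
  have := card_ker (crR v) (crR_ne h)
  rw [Nat.card_prod, Nat.card_eq_fintype_card (α := F)] at this
  exact Nat.eq_of_mul_eq_mul_right Fintype.card_pos this

theorem cardK (u w : F × F) (h : ¬ (u = 0 ∧ w = 0)) :
    Nat.card {p : (F × F) × (F × F) // cr u p.2 + cr p.1 w = 0} = Fintype.card F ^ 3 := by
  have := card_ker ((crR u).comp (LinearMap.snd F (F × F) (F × F)) +
    (crL w).comp (LinearMap.fst F (F × F) (F × F))) (by
      intro h0
      apply h
      constructor
      · by_contra hu
        apply crR_ne hu
        apply LinearMap.ext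
        intro y
        have := LinearMap.congr_fun h0 (0, y)
        simpa using this
      · by_contra hu
        apply crL_ne hu
        apply LinearMap.ext
        intro y
        have := LinearMap.congr_fun h0 (y, 0)
        simpa using this)
  simp only [Nat.card_prod, Nat.card_eq_fintype_card (α := F)] at this
  apply Nat.eq_of_mul_eq_mul_right (Fintype.card_pos (α := F))
  refine Eq.trans this ?_
  ring

open Classical in
theorem cardK' (u w : F × F) :
    (Nat.card {p : (F × F) × (F × F) // cr u p.2 + cr p.1 w = 0} : ℤ) = Fintype.card F ^ 3 +
      (if u = 0 ∧ w = 0 then (Fintype.card F : ℤ) ^ 4 - Fintype.card F ^ 3 else 0) := by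
  split_ifs with h
  · obtain ⟨rfl, rfl⟩ := h
    simp [cr]
    ring
  · rw [cardK u w h]; simp

open Classical in
theorem cardS (v : F × F) :
    (Nat.card (Σ s : {u : F × F // cr u v = 0} × {w : F × F // cr v w = 0},
      {p : (F × F) × (F × F) // cr s.1.1 p.2 + cr p.1 s.2.1 = 0}) : ℤ) =
    (if v = 0 then (Fintype.card F : ℤ) ^ 4 - Fintype.card F ^ 2 else 0) * Fintype.card F ^ 3
     + Fintype.card F ^ 5 + (Fintype.card F ^ 4 - Fintype.card F ^ 3) := by
  have key : (Nat.card {u : F × F // cr u v = 0} * Nat.card {w : F × F // cr v w = 0} : ℤ)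
      = (if v = 0 then (Fintype.card F : ℤ) ^ 4 - Fintype.card F ^ 2 else 0)
        + Fintype.card F ^ 2 := by
    split_ifs with h
    · subst h
      simp [cr]
      ring
    · rw [cardL v h, cardR v h]; ring
  rw [Nat.card_sigma]
  push_cast
  simp only [cardK']
  rw [Finset.sum_add_distrib, Finset.sum_const, Finset.card_univ, ← Nat.card_eq_fintype_card,
    Nat.card_prod, nsmul_eq_mul, Nat.cast_mul, key]
  rw [Finset.sum_eq_single (⟨⟨0, by simp [cr]⟩, ⟨0, by simp [cr]⟩⟩ :
    {u : F × F // cr u v = 0} × {w : F × F // cr v w = 0})]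
  · split_ifs <;> simp_all <;> ring
  · intro b _ hb
    rw [if_neg]
    rintro ⟨h1, h2⟩
    exact hb (Prod.ext (Subtype.ext h1) (Subtype.ext h2))
  · simp

theorem cardPar : (Nat.card (Par F) : ℤ) =
    (2 * (Fintype.card F : ℤ) ^ 3 + Fintype.card F ^ 2 - 2 * Fintype.card F)
      * Fintype.card F ^ 6 := by
  classical
  rw [Nat.card_prod, Nat.card_sigma]
  push_cast
  simp only [cardS]
  simp only [Finset.sum_add_distrib, ← Finset.sum_mul, Finset.sum_ite_eq', Finset.sum_const]
  simp
  ring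

end UTcount

theorem stmt2 (F : Type*) [Field F] [Fintype F] :
    Nat.card (ConjClasses (UT 4 F)) =
      2 * (Fintype.card F) ^ 3 + (Fintype.card F) ^ 2 - 2 * Fintype.card F := by
  have h := card_comm_eq_card_conjClasses_mul_card (UT 4 F)
  rw [Nat.card_congr UTcount.eqv2, Nat.card_congr (UTcount.eqv (F := F))] at h
  have h' := UTcount.cardPar (F := F)
  rw [h] at h'
  simp only [Nat.card_prod, Nat.card_eq_fintype_card (α := F)] at h'
  have hq : (Fintype.card F : ℤ) ^ 6 ≠ 0 := by
    have := Fintype.card_pos (α := F)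
    positivity
  have h2 : (Nat.card (ConjClasses (UT 4 F)) : ℤ) =
      2 * (Fintype.card F : ℤ) ^ 3 + Fintype.card F ^ 2 - 2 * Fintype.card F := by
    apply mul_right_cancel₀ hq
    rw [← h']
    push_cast
    ring
  have h3 : Nat.card (ConjClasses (UT 4 F)) + 2 * Fintype.card F =
      2 * (Fintype.card F) ^ 3 + (Fintype.card F) ^ 2 := by
    zify
    rw [h2]; ring
  omega
end

section
/- The number of conjugacy classes of the group of 5×5 upper unitriangular matrices over F_q, written as a polynomial in v = q - 1, equals 5v^4 + 20v^3 + 25v^2 + 10v + 1, and all coefficients of this polynomial in v are non-negative integers with constant term 1. -/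
open Matrix

section CountHelpers

set_option linter.unusedSectionVars false

variable {F : Type*} [Field F] [Fintype F] [DecidableEq F]

def hD (x y : F × F) : F := x.1 * y.2 - x.2 * y.1
def hδ (x : F) : ℤ := if x = 0 then 1 else 0
def hε (x : F × F) : ℤ := if x = 0 then 1 else 0
def hq (F : Type*) [Fintype F] : ℤ := (Fintype.card F : ℤ)

lemma h_sum1 (a k : F) (ha : a ≠ 0) (g : F → ℤ) :
    ∑ t, hδ (a * t + k) * g t = g (-k / a) := by
  have : ∀ t, (a * t + k = 0) ↔ t = -k / a := by
    intro t
    rw [eq_div_iff ha]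
    constructor
    · intro h; linear_combination h
    · intro h; linear_combination h
  simp [hδ, this]

lemma h_eps (f : F × F → ℤ) : ∑ u, hε u * f u = f 0 := by
  simp [hε]

lemma h_sumV (c : ℤ) : ∑ _u : F × F, c = hq F ^ 2 * c := by
  simp only [Finset.sum_const, Finset.card_univ, Fintype.card_prod, hq, nsmul_eq_mul]
  push_cast; ring

lemma h_D_swap (x y : F × F) : hD x y = - hD y x := by
  simp only [hD]; ring

lemma h_δ_neg (x : F) : hδ (-x) = hδ x := by simp [hδ]

lemma h_δ_swap (x y : F × F) : hδ (hD x y) = hδ (hD y x) := by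
  rw [h_D_swap, h_δ_neg]

lemma h_lin (x : F × F) (k : F) :
    ∑ z, hδ (hD x z + k) = hq F + hε x * (hq F ^ 2 * hδ k - hq F) := by
  obtain ⟨a, b⟩ := x
  by_cases ha : a = 0
  · by_cases hb : b = 0
    · subst ha hb
      have h0 : ∀ z : F × F, hδ (hD ((0 : F), (0 : F)) z + k) = hδ k := by simp [hD]
      simp only [h0, h_sumV]
      simp [hε]
    · subst ha
      rw [Fintype.sum_prod_type, Finset.sum_comm]
      have := h_sum1 (-b) k (by simpa using hb) (fun _ => 1)
      simp only [mul_one] at this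
      simp [hD, hε, hq, hb]
      simp [← neg_mul, this]
  · rw [Fintype.sum_prod_type]
    have : ∀ x y : F, hδ (a * y - b * x + k) = hδ (a * y + (k - b * x)) * 1 := by
      intro x y; rw [mul_one]; congr 1; ring
    have h2 := fun x : F => h_sum1 a (k - b * x) ha (fun _ => 1)
    simp only [hD, this, h2]
    simp [hε, hq, ha]

lemma h_lin' (x : F × F) (k : F) :
    ∑ z, hδ (hD z x + k) = hq F + hε x * (hq F ^ 2 * hδ k - hq F) := by
  rw [← h_δ_neg k, ← h_lin]
  refine Finset.sum_congr rfl fun z _ => ?_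
  rw [h_D_swap, ← h_δ_neg]; congr 1; ring

lemma h_A (x : F × F) :
    ∑ z, hδ (hD x z) = hq F + hε x * (hq F ^ 2 - hq F) := by
  have := h_lin x 0
  simpa [hδ] using this

lemma h_A' (x : F × F) :
    ∑ z, hδ (hD z x) = hq F + hε x * (hq F ^ 2 - hq F) := by
  simp only [h_δ_swap _ x, h_A]

lemma h_B (x y : F × F) :
    ∑ z, hδ (hD x z) * hδ (hD z y) =
      1 + hδ (hD x y) * (hq F - 1) + hε x * hε y * (hq F ^ 2 - hq F) := by
  obtain ⟨a, b⟩ := x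
  have key : ∀ s : F, s ≠ 0 → ∑ t : F, hδ (s * t) =  1 := by
    intro s hs
    have := h_sum1 s 0 hs (fun _ => 1)
    simpa using this
  have key2 : ∀ s r : F, r ≠ 0 → ∑ t : F, hδ (s * t / r) = 1 + hδ s * (hq F - 1) := by
    intro s r hr
    by_cases hs : s = 0
    · subst hs; simp [hδ, hq]
    · have := key (s / r) (div_ne_zero hs hr)
      simp only [div_mul_eq_mul_div] at this
      rw [this]; simp [hδ, hs]
  by_cases ha : a = 0
  · by_cases hb : b = 0
    · subst ha hb
      have := h_A' y
      simp [hD, hδ] at this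
      simp [hD, hε, hδ, this]
    · subst ha
      rw [Fintype.sum_prod_type, Finset.sum_comm]
      have : ∀ p r : F, hδ (hD (0, b) (p, r)) * hδ (hD (p, r) y)
          = hδ (-b * p + 0) * hδ (hD (p, r) y) := by
        intro p r; congr 2; simp [hD]
      simp only [this, h_sum1 (-b) 0 (by simpa using hb)]
      rw [← key2 (hD (0, b) y) b hb]
      simp only [hε, Prod.mk_eq_zero, hb, and_false, if_false, zero_mul, add_zero]
      refine Finset.sum_congr rfl fun t _ => ?_
      congr 1
      simp only [hD]; field_simp; ring
  · rw [Fintype.sum_prod_type]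
    have : ∀ p r : F, hδ (hD (a, b) (p, r)) * hδ (hD (p, r) y)
          = hδ (a * r + (- b * p)) * hδ (hD (p, r) y) := by
        intro p r; congr 2; simp [hD, sub_eq_add_neg]
    simp only [this, fun p => h_sum1 a (-b * p) ha]
    rw [← key2 (hD (a, b) y) a ha]
    simp only [hε, Prod.mk_eq_zero, ha, false_and, if_false, zero_mul, add_zero]
    refine Finset.sum_congr rfl fun t _ => ?_
    congr 1
    simp only [hD]; field_simp

lemma h_z (x y : F × F) (k : F) :
    ∑ z1, ∑ z2, hδ (hD x z2 + k + hD z1 y) =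
      hq F ^ 3 + hε x * hε y * (hq F ^ 4 * hδ k - hq F ^ 3) := by
  have : ∀ z1, ∑ z2, hδ (hD x z2 + k + hD z1 y) =
     hq F + hε x * (hq F ^ 2 * hδ (hD z1 y + k) - hq F) := by
    intro z1
    rw [← h_lin]
    refine Finset.sum_congr rfl fun t _ => ?_
    congr 1; ring
  simp only [this, Finset.sum_add_distrib, ← Finset.mul_sum, Finset.sum_sub_distrib, h_lin', h_sumV]
  ring

lemma h_S1 : ∑ x : F × F, ∑ y, hδ (hD x y) = hq F ^ 3 + hq F ^ 2 - hq F := by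
  simp only [h_A, Finset.sum_add_distrib, h_sumV, h_eps]
  ring

lemma h_eps_sq (x : F × F) : hε x * hε x = hε x := by simp [hε]
lemma h_δ_sq (x : F) : hδ x * hδ x = hδ x := by simp [hδ]
lemma h_eps_δ (x y : F × F) : hε x * hδ (hD x y) = hε x := by
  by_cases h : x = 0
  · subst h; simp [hδ, hD]
  · simp [hε, h]
lemma h_eps_δ' (x y : F × F) : hε y * hδ (hD x y) = hε y := by
  rw [h_δ_swap, h_eps_δ]

lemma h_sumEps : ∑ x : F × F, hε x = 1 := by simp [hε]

lemma h_C4 : ∑ x : F × F, ∑ y, (∑ z, hδ (hD x z) * hδ (hD z y)) ^ 2 =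
    hq F ^ 5 + 3 * hq F ^ 4 - 2 * hq F ^ 3 - 2 * hq F ^ 2 + hq F := by
  have : ∀ x y : F × F, (∑ z, hδ (hD x z) * hδ (hD z y)) ^ 2 =
      1 + hδ (hD x y) * (hq F ^ 2 - 1) + hε x * (hε y * (hq F ^ 4 - hq F ^ 2)) := by
    intro x y
    rw [h_B]
    have h1 := h_eps_sq x
    have h2 := h_eps_sq y
    have h3 := h_δ_sq (hD x y)
    have h4 := h_eps_δ x y
    generalize hε x = e at *
    generalize hε y = f at *
    generalize hδ (hD x y) = d at *
    generalize hq F = q at *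
    linear_combination (q-1)^2 * h3 + 2 * (q-1)*(q^2-q)*f*h4 + (q^2-q)^2*(f^2*h1 + e * h2)
  simp only [this, Finset.sum_add_distrib, h_sumV, ← Finset.mul_sum, ← Finset.sum_mul, h_eps, h_S1, h_sumEps]
  ring

lemma h_P4 : ∑ x : F × F, ∑ y, hδ (hD x y) * (∑ z, hδ (hD z x)) * (∑ z, hδ (hD y z)) =
    3 * hq F ^ 5 - 3 * hq F ^ 3 + hq F ^ 2 := by
  have : ∀ x y : F × F, hδ (hD x y) * (∑ z, hδ (hD z x)) * (∑ z, hδ (hD y z)) =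
      hδ (hD x y) * hq F ^ 2 + (hε x + hε y) * (hq F * (hq F ^ 2 - hq F))
        + hε x * (hε y * (hq F ^ 2 - hq F) ^ 2) := by
    intro x y
    rw [h_A, h_A']
    have h4 := h_eps_δ x y
    have h5 := h_eps_δ' x y
    generalize hε x = e at *
    generalize hε y = f at *
    generalize hδ (hD x y) = d at *
    generalize hq F = q at *
    linear_combination q * (q^2-q)*(h4+h5) + (q^2-q)^2*f*h4
  simp only [this, Finset.sum_add_distrib, h_sumV, ← Finset.mul_sum, ← Finset.sum_mul, h_S1, h_sumEps]
  ring

lemma h_eps_D (x y : F × F) : hε x * hδ (hD x y) = hε x := h_eps_δ x y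

lemma h_T1 : ∑ u2 : F × F, ∑ u3, ∑ w2, hδ (hD u2 u3) *
      (∑ u1, hδ (hD u1 u2) * (hq F + hε u3 * (hq F ^ 2 * hδ (hD u1 w2) - hq F))) *
      (∑ u4, hδ (hD u3 u4) * (hq F + hε u2 * (hq F ^ 2 * hδ (hD w2 u4) - hq F))) =
    hq F ^ 6 * (5 * hq F ^ 3 - hq F ^ 2 - 5 * hq F + 2) := by
  set q := hq F with hqd
  have e1 : ∀ u2 u3 w2 : F × F,
      (∑ u1, hδ (hD u1 u2) * (q + hε u3 * (q ^ 2 * hδ (hD u1 w2) - q))) =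
      (q + hε u2 * (q ^ 2 - q)) * (q - q * hε u3) + hε u3 * q ^ 2 *
       (1 + hδ (hD u2 w2) * (q - 1) + hε u2 * hε w2 * (q ^ 2 - q)) := by
    intro u2 u3 w2
    rw [← h_B, ← h_A', Finset.mul_sum, Finset.sum_mul, ← Finset.sum_add_distrib]
    refine Finset.sum_congr rfl fun t _ => ?_
    rw [h_δ_swap u2 t]; ring
  have e2 : ∀ u2 u3 w2 : F × F,
      (∑ u4, hδ (hD u3 u4) * (q + hε u2 * (q ^ 2 * hδ (hD w2 u4) - q))) =
      (q + hε u3 * (q ^ 2 - q)) * (q - q * hε u2) + hε u2 * q ^ 2 *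
       (1 + hδ (hD u3 w2) * (q - 1) + hε u3 * hε w2 * (q ^ 2 - q)) := by
    intro u2 u3 w2
    rw [← e1]
    refine Finset.sum_congr rfl fun t _ => ?_
    rw [h_δ_swap u3 t, h_δ_swap w2 t]
  have e3 : ∀ u2 u3 w2 : F × F, hδ (hD u2 u3) *
      (∑ u1, hδ (hD u1 u2) * (q + hε u3 * (q ^ 2 * hδ (hD u1 w2) - q))) *
      (∑ u4, hδ (hD u3 u4) * (q + hε u2 * (q ^ 2 * hδ (hD w2 u4) - q))) =
      q ^ 4 * (hδ (hD u2 u3) + hε u2 * (hε u3 - 1) - hε u3)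
      + q ^ 5 * (hε u3 * (1 - hε u2)) * (1 + hδ (hD u2 w2) * (q - 1))
      + q ^ 5 * (hε u2 * (1 - hε u3)) * (1 + hδ (hD u3 w2) * (q - 1))
      + q ^ 4 * (hε u2 * hε u3) * (q ^ 2 + hε w2 * (q ^ 4 - q ^ 2)) := by
    intro u2 u3 w2
    rw [e1, e2]
    by_cases h2 : u2 = 0 <;> by_cases h3 : u3 = 0 <;> by_cases hw : w2 = 0 <;>
      simp [h2, h3, hw, hε, hδ, hD] <;> first | ring | (split_ifs <;> ring)
  have e4 : ∀ u2 u3 : F × F, ∑ w2 : F × F, (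
      q ^ 4 * (hδ (hD u2 u3) + hε u2 * (hε u3 - 1) - hε u3)
      + q ^ 5 * (hε u3 * (1 - hε u2)) * (1 + hδ (hD u2 w2) * (q - 1))
      + q ^ 5 * (hε u2 * (1 - hε u3)) * (1 + hδ (hD u3 w2) * (q - 1))
      + q ^ 4 * (hε u2 * hε u3) * (q ^ 2 + hε w2 * (q ^ 4 - q ^ 2))) =
      hδ (hD u2 u3) * q ^ 6 + (hε u2 + hε u3) * (q ^ 5 * (2 * q ^ 2 - q) - q ^ 6)
       + hε u2 * (hε u3 * (q ^ 6 - 2 * q ^ 5 * (2 * q ^ 2 - q) + q ^ 4 * (2 * q ^ 4 - q ^ 2))) := by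
    intro u2 u3
    simp only [Finset.sum_add_distrib, ← Finset.mul_sum, ← Finset.sum_mul, h_sumV, h_A, h_sumEps,
      ← hqd]
    have h1 := h_eps_sq u2
    have h2 := h_eps_sq u3
    generalize hε u2 = e at *
    generalize hε u3 = f at *
    linear_combination -q^5*(q-1)*(q^2-q)*(f*h1+e*h2)
  simp only [e3, e4]
  simp only [Finset.sum_add_distrib, h_sumV, ← Finset.mul_sum, ← Finset.sum_mul, h_S1, h_sumEps]
  ring

def hX (u2 u3 w2 u1 u4 w1 w3 : F × F) : ℤ :=
  hδ (hD u1 u2) * hδ (hD u2 u3) * hδ (hD u3 u4) * hδ (hD u1 w2 + hD w1 u3) *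
    hδ (hD u2 w3 + hD w2 u4)

lemma h_X1 : ∑ u2 : F × F, ∑ u3 : F × F, ∑ w2 : F × F, ∑ u1 : F × F, ∑ u4 : F × F,
    ∑ w1 : F × F, ∑ w3 : F × F, hX u2 u3 w2 u1 u4 w1 w3 =
    hq F ^ 6 * (5 * hq F ^ 3 - hq F ^ 2 - 5 * hq F + 2) := by
  rw [← h_T1]
  refine Finset.sum_congr rfl fun u2 _ => Finset.sum_congr rfl fun u3 _ =>
    Finset.sum_congr rfl fun w2 _ => ?_
  rw [mul_assoc, Finset.sum_mul_sum, Finset.mul_sum]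
  refine Finset.sum_congr rfl fun u1 _ => ?_
  rw [Finset.mul_sum]
  refine Finset.sum_congr rfl fun u4 _ => ?_
  have a1 := h_lin' u3 (hD u1 w2)
  have a2 := h_lin u2 (hD w2 u4)
  rw [← a1, ← a2]
  rw [Finset.mul_sum, Finset.mul_sum, Finset.sum_mul_sum, Finset.mul_sum]
  refine Finset.sum_congr rfl fun w1 _ => ?_
  rw [Finset.mul_sum]
  refine Finset.sum_congr rfl fun w3 _ => ?_
  rw [hX, add_comm (hD w1 u3)]; ring

lemma h_collapse (g : F × F → F × F → ℤ) (u2 u3 w2 : F × F) :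
    ∑ u1 : F × F, ∑ u4 : F × F, ∑ w1 : F × F, ∑ w3 : F × F,
      hX u2 u3 w2 u1 u4 w1 w3 * (hε u1 * hε u4 * g w1 w3) =
    ∑ w1 : F × F, ∑ w3 : F × F, hδ (hD u2 u3) * hδ (hD w1 u3) * hδ (hD u2 w3) * g w1 w3 := by
  have : ∀ u1 u4 : F × F, ∑ w1 : F × F, ∑ w3 : F × F,
      hX u2 u3 w2 u1 u4 w1 w3 * (hε u1 * hε u4 * g w1 w3) =
      hε u1 * (hε u4 * ∑ w1 : F × F, ∑ w3 : F × F, hX u2 u3 w2 u1 u4 w1 w3 * g w1 w3) := by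
    intro u1 u4
    simp only [Finset.mul_sum]
    refine Finset.sum_congr rfl fun w1 _ => Finset.sum_congr rfl fun w3 _ => ?_
    ring
  simp only [this, ← Finset.mul_sum, h_eps]
  refine Finset.sum_congr rfl fun w1 _ => Finset.sum_congr rfl fun w3 _ => ?_
  have h0 : ∀ z : F × F, hD 0 z = 0 := by simp [hD]
  have h0' : ∀ z : F × F, hD z 0 = 0 := by simp [hD]
  have h1 : hδ (0 : F) = 1 := by simp [hδ]
  simp only [hX, h0, h0', h1, zero_add, add_zero, one_mul, mul_one]

lemma h_X2 : ∑ u2 : F × F, ∑ u3 : F × F, ∑ w2 : F × F, ∑ u1 : F × F, ∑ u4 : F × F,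
    ∑ w1 : F × F, ∑ w3 : F × F, hX u2 u3 w2 u1 u4 w1 w3 * (hε u1 * hε u4 * hδ (hD w1 w3)) =
    hq F ^ 2 * (hq F ^ 5 + 3 * hq F ^ 4 - 2 * hq F ^ 3 - 2 * hq F ^ 2 + hq F) := by
  simp only [h_collapse (fun w1 w3 => hδ (hD w1 w3)), h_sumV, ← Finset.mul_sum]
  rw [← h_C4]
  congr 1
  refine Finset.sum_congr rfl fun u2 _ => ?_
  rw [Finset.sum_comm]
  refine Finset.sum_congr rfl fun w1 _ => ?_
  rw [sq, Finset.sum_mul_sum]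
  refine Finset.sum_congr rfl fun u3 _ => ?_
  refine Finset.sum_congr rfl fun w3 _ => ?_
  rw [h_δ_swap w1 u3, h_δ_swap w1 w3]; ring

lemma h_X3 : ∑ u2 : F × F, ∑ u3 : F × F, ∑ w2 : F × F, ∑ u1 : F × F, ∑ u4 : F × F,
    ∑ w1 : F × F, ∑ w3 : F × F, hX u2 u3 w2 u1 u4 w1 w3 * (hε u1 * hε u4 * 1) =
    hq F ^ 2 * (3 * hq F ^ 5 - 3 * hq F ^ 3 + hq F ^ 2) := by
  simp only [h_collapse (fun w1 w3 => 1), h_sumV, ← Finset.mul_sum]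
  rw [← h_P4]
  congr 1
  refine Finset.sum_congr rfl fun u2 _ => ?_
  refine Finset.sum_congr rfl fun u3 _ => ?_
  rw [mul_assoc, Finset.sum_mul_sum, Finset.mul_sum, Finset.sum_comm]
  refine Finset.sum_congr rfl fun w1 _ => ?_
  rw [Finset.mul_sum]
  refine Finset.sum_congr rfl fun w3 _ => ?_
  rw [h_δ_swap w1 u2, h_δ_swap w3 u3]; ring

lemma h_total : ∑ u2 : F × F, ∑ u3 : F × F, ∑ w2 : F × F, ∑ u1 : F × F, ∑ u4 : F × F,
    ∑ w1 : F × F, ∑ w3 : F × F, ∑ z1 : F × F, ∑ z2 : F × F, ∑ _t : F × F,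
      hX u2 u3 w2 u1 u4 w1 w3 * hδ (hD u1 z2 + hD w1 w3 + hD z1 u4) =
    hq F ^ 10 * (5 * hq F ^ 4 - 5 * hq F ^ 2 + 1) := by
  simp only [h_sumV, ← Finset.mul_sum, h_z]
  have : ∀ u2 u3 w2 u1 u4 w1 w3 : F × F, hX u2 u3 w2 u1 u4 w1 w3 *
      (hq F ^ 2 * (hq F ^ 3 + hε u1 * hε u4 * (hq F ^ 4 * hδ (hD w1 w3) - hq F ^ 3))) =
      hq F ^ 5 * hX u2 u3 w2 u1 u4 w1 w3
       + hq F ^ 6 * (hX u2 u3 w2 u1 u4 w1 w3 * (hε u1 * hε u4 * hδ (hD w1 w3)))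
       - hq F ^ 5 * (hX u2 u3 w2 u1 u4 w1 w3 * (hε u1 * hε u4 * 1)) := by
    intros; ring
  simp only [this, Finset.sum_add_distrib, Finset.sum_sub_distrib]
  simp only [← Finset.mul_sum]
  rw [h_X1, h_X2, h_X3]
  ring

def hM (a b c d e f g h i j : F) : Matrix (Fin 5) (Fin 5) F :=
  !![1, a, e, h, j; 0, 1, b, f, i; 0, 0, 1, c, g; 0, 0, 0, 1, d; 0, 0, 0, 0, 1]


lemma hM_uni (a b c d e f g h i j : F) : IsUnitriangular (hM a b c d e f g h i j) := by
  constructor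
  · intro k; fin_cases k <;> rfl
  · intro k l hkl
    fin_cases k <;> fin_cases l <;> first | rfl | (exfalso; revert hkl; decide)


lemma hM_det (a b c d e f g h i j : F) : (hM a b c d e f g h i j).det ≠ 0 := by
  rw [Matrix.det_of_upperTriangular (hM_uni a b c d e f g h i j).blockTriangular]
  simp [(hM_uni a b c d e f g h i j).1]

def hU (a b c d e f g h i j : F) : UT 5 F :=
  ⟨Matrix.GeneralLinearGroup.mkOfDetNeZero (hM a b c d e f g h i j) (hM_det a b c d e f g h i j),
    hM_uni a b c d e f g h i j⟩


lemma hU_val (a b c d e f g h i j : F) :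
  (((hU a b c d e f g h i j : UT 5 F) : GL (Fin 5) F) : Matrix (Fin 5) (Fin 5) F)
    = hM a b c d e f g h i j := rfl


lemma hU_surj (A : UT 5 F) : 
    hU (A.1.1 0 1) (A.1.1 1 2) (A.1.1 2 3) (A.1.1 3 4) (A.1.1 0 2) (A.1.1 1 3) (A.1.1 2 4)
     (A.1.1 0 3) (A.1.1 1 4) (A.1.1 0 4) = A := by
  obtain ⟨A, hA1, hA2⟩ := A
  apply Subtype.ext
  apply Units.ext
  rw [hU_val]
  ext k l
  fin_cases k <;> fin_cases l <;> first | rfl | exact (hA1 _).symm | exact (hA2 _ _ (by decide)).symm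

abbrev hW (F : Type*) := F × F

def hEquiv1 : F × F × F × F × F × F × F × F × F × F ≃ UT 5 F where
  toFun p := hU p.1 p.2.1 p.2.2.1 p.2.2.2.1 p.2.2.2.2.1 p.2.2.2.2.2.1 p.2.2.2.2.2.2.1
    p.2.2.2.2.2.2.2.1 p.2.2.2.2.2.2.2.2.1 p.2.2.2.2.2.2.2.2.2
  invFun A := (A.1.1 0 1, A.1.1 1 2, A.1.1 2 3, A.1.1 3 4, A.1.1 0 2, A.1.1 1 3, A.1.1 2 4,
     A.1.1 0 3, A.1.1 1 4, A.1.1 0 4)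
  left_inv p := rfl
  right_inv A := hU_surj A

def hEquiv2 : hW F × hW F × hW F × hW F × hW F × hW F × hW F × hW F × hW F × hW F ≃
    UT 5 F × UT 5 F where
  toFun := fun ⟨u2, u3, w2, u1, u4, w1, w3, z1, z2, t⟩ =>
    (hU u1.1 u2.1 u3.1 u4.1 w1.1 w2.1 w3.1 z1.1 z2.1 t.1,
     hU u1.2 u2.2 u3.2 u4.2 w1.2 w2.2 w3.2 z1.2 z2.2 t.2)
  invFun P :=
    ((P.1.1.1 1 2, P.2.1.1 1 2), (P.1.1.1 2 3, P.2.1.1 2 3), (P.1.1.1 1 3, P.2.1.1 1 3),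
     (P.1.1.1 0 1, P.2.1.1 0 1), (P.1.1.1 3 4, P.2.1.1 3 4), (P.1.1.1 0 2, P.2.1.1 0 2),
     (P.1.1.1 2 4, P.2.1.1 2 4), (P.1.1.1 0 3, P.2.1.1 0 3), (P.1.1.1 1 4, P.2.1.1 1 4),
     (P.1.1.1 0 4, P.2.1.1 0 4))
  left_inv p := rfl
  right_inv P := Prod.ext (hU_surj P.1) (hU_surj P.2)


lemma h_comm (a b c d e f g h i j a' b' c' d' e' f' g' h' i' j' : F) :
    Commute (hU a b c d e f g h i j) (hU a' b' c' d' e' f' g' h' i' j') ↔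
    hD (a, a') (b, b') = 0 ∧ hD (b, b') (c, c') = 0 ∧ hD (c, c') (d, d') = 0 ∧
    hD (a, a') (f, f') + hD (e, e') (c, c') = 0 ∧ hD (b, b') (g, g') + hD (f, f') (d, d') = 0 ∧
    hD (a, a') (i, i') + hD (e, e') (g, g') + hD (h, h') (d, d') = 0 := by
  have : Commute (hU a b c d e f g h i j) (hU a' b' c' d' e' f' g' h' i' j') ↔
    hM a b c d e f g h i j * hM a' b' c' d' e' f' g' h' i' j' =
    hM a' b' c' d' e' f' g' h' i' j' * hM a b c d e f g h i j := by
    rw [commute_iff_eq, Subtype.ext_iff, Units.ext_iff]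
    rfl
  rw [this]
  simp only [hD]
  constructor
  · intro H
    have H' := fun k l => congrFun (congrFun H k) l
    have h1 := H' 0 2
    have h2 := H' 1 3
    have h3 := H' 2 4
    have h4 := H' 0 3
    have h5 := H' 1 4
    have h6 := H' 0 4
    simp [hM, Matrix.mul_apply, Fin.sum_univ_five] at h1 h2 h3 h4 h5 h6
    refine ⟨?_, ?_, ?_, ?_, ?_, ?_⟩
    · linear_combination h1
    · linear_combination h2
    · linear_combination h3
    · linear_combination h4
    · linear_combination h5
    · linear_combination h6
  · rintro ⟨h1, h2, h3, h4, h5, h6⟩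
    ext k l
    fin_cases k <;> fin_cases l <;> simp [hM, Matrix.mul_apply, Fin.sum_univ_five]
    all_goals first
      | ring1
      | linear_combination h1
      | linear_combination h2
      | linear_combination h3
      | linear_combination h4
      | linear_combination h5
      | linear_combination h6


lemma h_δ_mul (P : Prop) [Decidable P] (Q : Prop) [Decidable Q] :
    (if P then (1 : ℤ) else 0) * (if Q then 1 else 0) = if P ∧ Q then 1 else 0 := by
  by_cases P <;> by_cases Q <;> simp [*]

lemma h_card_comm : (Nat.card {p : UT 5 F × UT 5 F // Commute p.1 p.2} : ℤ) =
    hq F ^ 10 * (5 * hq F ^ 4 - 5 * hq F ^ 2 + 1) := by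
  classical
  haveI : Fintype (UT 5 F) := Fintype.ofEquiv _ (hEquiv1 (F := F))
  rw [Nat.card_eq_fintype_card, Fintype.card_subtype, Finset.card_filter]
  push_cast
  rw [← (hEquiv2 (F := F)).sum_comp]
  simp only [Fintype.sum_prod_type_right', Fintype.sum_prod_type (α₁ := hW F)]
  rw [← h_total]
  refine Finset.sum_congr rfl fun u2 _ => Finset.sum_congr rfl fun u3 _ =>
    Finset.sum_congr rfl fun w2 _ => Finset.sum_congr rfl fun u1 _ =>
    Finset.sum_congr rfl fun u4 _ => Finset.sum_congr rfl fun w1 _ =>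
    Finset.sum_congr rfl fun w3 _ => Finset.sum_congr rfl fun z1 _ =>
    Finset.sum_congr rfl fun z2 _ => Finset.sum_congr rfl fun t _ => ?_
  have hc := h_comm u1.1 u2.1 u3.1 u4.1 w1.1 w2.1 w3.1 z1.1 z2.1 t.1
     u1.2 u2.2 u3.2 u4.2 w1.2 w2.2 w3.2 z1.2 z2.2 t.2
  simp only [Prod.mk.eta] at hc
  refine (if_congr hc rfl rfl).trans ?_
  simp only [hX, hδ, h_δ_mul, and_assoc]

lemma h_card_UT : (Nat.card (UT 5 F) : ℤ) = hq F ^ 10 := by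
  rw [← Nat.card_congr (hEquiv1 (F := F))]
  simp [hq, Nat.card_eq_fintype_card]
  ring

end CountHelpers

theorem stmt3 (F : Type*) [Field F] [Fintype F] (v : ℕ) (hv : v = Fintype.card F - 1) :
    Nat.card (ConjClasses (UT 5 F)) =
      5 * v ^ 4 + 20 * v ^ 3 + 25 * v ^ 2 + 10 * v + 1 := by
  classical
  have h1 := card_comm_eq_card_conjClasses_mul_card (UT 5 F)
  have h2 := h_card_comm (F := F)
  have h3 := h_card_UT (F := F)
  have hpos : 0 < Fintype.card F := Fintype.card_pos
  have hqv : hq F = (v : ℤ) + 1 := by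
    simp only [hq]; omega
  have hne : hq F ^ 10 ≠ 0 := by
    apply pow_ne_zero; rw [hqv]; positivity
  rw [h1] at h2
  push_cast at h2
  rw [h3, mul_comm] at h2
  have h4 := mul_left_cancel₀ hne h2
  rw [hqv] at h4
  zify
  rw [h4]; ring
end
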